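/- There exists an absolute constant c such that the following holds. For N, t, l, m ∈ ℕ with 0 ≤ t < l < N and m ≥ 1, let L_m^2 := (1/m) Σ_{i=0}^{|m|−1} 2^i r_i · (K_{2^i}^w ∘ τ_i), and let x ∈ J_t^l, where J_t^l := I_N(0,…,0,x_t=1,0,…,0,x_l=1,x_{l+1},…,x_{N−1}) is the set of y ∈ G with y_0 = ⋯ = y_{t−1} = 0, y_t = 1, y_{t+1} = ⋯ = y_{l−1} = 0, y_l = 1 (coordinates y_{l+1},…,y_{N−1} arbitrary). Then ∫_{I_N} |L_m^2(x+s)| dμ(s) ≤ c · (2^{2t} + 2^{2l−t}) · 2^{−N} / m. -/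

import Mathlib

open MeasureTheory Filter
open scoped ENNReal

noncomputable section

namespace WalshKaczmarz

/-- The Walsh group `G`: sequences of elements of `ZMod 2` with coordinatewise
addition modulo 2. -/
abbrev G : Type := ℕ → ZMod 2

instance : MeasurableSpace (ZMod 2) := ⊤

/-- The normalized Haar (product) measure on `G`, realized as the pushforward of
Lebesgue measure on `[0,1)` under the binary digit expansion map. Each coordinate
is uniformly distributed on `ZMod 2` and coordinates are independent.  -/
def μG : Measure G :=
  Measure.map (fun t : ℝ => fun k : ℕ => ((⌊t * 2 ^ (k + 1)⌋ : ℤ) : ZMod 2))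
    (volume.restrict (Set.Ico (0 : ℝ) 1))

/-- The dyadic interval `I_n(x)`. -/
def I (n : ℕ) (x : G) : Set G := {y : G | ∀ k < n, y k = x k}

/-- `e n` : the element of `G` whose `n`-th coordinate is `1` and all others `0`. -/
def e (n : ℕ) : G := fun k => if k = n then 1 else 0

/-- The `k`-th Rademacher function `r_k(x) = (-1)^{x_k}`. -/
def rademacher (k : ℕ) (x : G) : ℝ := (-1 : ℝ) ^ (x k).val

/-- `|n| = max {j : n_j ≠ 0}`, the order of `n ≥ 1`. -/
def order (n : ℕ) : ℕ := Nat.log 2 n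

/-- The Walsh–Paley function `w_n = ∏_k r_k^{n_k}`. -/
def walsh (n : ℕ) (x : G) : ℝ :=
  ∏ k ∈ Finset.range n, (if n.testBit k then rademacher k x else 1)

/-- The Walsh–Kaczmarz function `κ_n`. -/
def kacz (n : ℕ) (x : G) : ℝ :=
  if n = 0 then 1 else
    rademacher (order n) x *
      (-1 : ℝ) ^ (∑ k ∈ Finset.range (order n),
        (if n.testBit k then (x (order n - 1 - k)).val else 0))

/-- Skvortsov's coordinate transformation `τ_A`. -/
def tau (A : ℕ) (x : G) : G := fun k => if k < A then x (A - 1 - k) else x k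

/-- The Walsh–Paley Dirichlet kernel `D_n^w`. -/
def dirW (n : ℕ) (x : G) : ℝ := ∑ k ∈ Finset.range n, walsh k x

/-- The Walsh–Kaczmarz Dirichlet kernel `D_n^κ`. -/
def dirK (n : ℕ) (x : G) : ℝ := ∑ k ∈ Finset.range n, kacz k x

/-- The Walsh–Paley Fejér kernel `K_n^w = (1/n) ∑_{k=0}^n D_k^w`. -/
def fejW (n : ℕ) (x : G) : ℝ := (1 / (n : ℝ)) * ∑ k ∈ Finset.range (n + 1), dirW k x

/-- The Walsh–Kaczmarz Fejér kernel `K_n^κ = (1/n) ∑_{k=0}^n D_k^κ`. -/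
def fejK (n : ℕ) (x : G) : ℝ := (1 / (n : ℝ)) * ∑ k ∈ Finset.range (n + 1), dirK k x

/-- The Walsh–Kaczmarz–Fourier coefficient of an integrable function. -/
def coeffK (f : G → ℝ) (k : ℕ) : ℝ := ∫ x, f x * kacz k x ∂μG

/-- The `n`-th Walsh–Kaczmarz partial sum `S_n^κ f`. -/
def SK (f : G → ℝ) (n : ℕ) (x : G) : ℝ := ∑ k ∈ Finset.range n, coeffK f k * kacz k x

/-- The `n`-th Walsh–Kaczmarz Fejér mean `σ_n^κ f = (1/n) ∑_{j=0}^n S_j^κ f`. -/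
def sigmaK (f : G → ℝ) (n : ℕ) (x : G) : ℝ :=
  (1 / (n : ℝ)) * ∑ j ∈ Finset.range (n + 1), SK f j x

/-- `𝔉_n` : the σ-algebra generated by the dyadic intervals of measure `2^{-n}`. -/
def F (n : ℕ) : MeasurableSpace G := MeasurableSpace.generateFrom {s | ∃ x : G, s = I n x}

/-- A martingale with respect to the filtration `(𝔉_n)` of dyadic σ-algebras. -/
def IsDyadicMartingale (f : ℕ → G → ℝ) : Prop :=
  (∀ n, Integrable (f n) μG) ∧ (∀ n, StronglyMeasurable[F n] (f n)) ∧
    ∀ n, μG[f (n + 1)|F n] =ᵐ[μG] f n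

/-- `‖f‖_{H_p}^p = ∫ (f^*)^p dμ` for a martingale `f`, where `f^* = sup_n |f^{(n)}|`
is the maximal function. -/
def martHpNormP (p : ℝ) (f : ℕ → G → ℝ) : ℝ≥0∞ :=
  ∫⁻ x, (⨆ n, ENNReal.ofReal |f n x|) ^ p ∂μG

/-- The martingale Hardy norm `‖f‖_{H_p} = ‖f^*‖_{L_p}`. -/
def martHpNorm (p : ℝ) (f : ℕ → G → ℝ) : ℝ≥0∞ := martHpNormP p f ^ (1 / p)

/-- Membership in the martingale Hardy space `H_p(G)`. -/
def MemHp (p : ℝ) (f : ℕ → G → ℝ) : Prop :=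
  IsDyadicMartingale f ∧ martHpNormP p f < ∞

/-- The maximal function of an integrable function `g`, i.e. of the martingale
`(S_{2^n} g)`:  `g^*(x) = sup_n (1/μ(I_n(x))) |∫_{I_n(x)} g dμ|`. -/
def funMaximal (g : G → ℝ) (x : G) : ℝ≥0∞ :=
  ⨆ n : ℕ, ENNReal.ofReal |∫ u in I n x, g u ∂μG| / μG (I n x)

/-- `‖g‖_{H_p}^p` for a function `g`, identified with the martingale `(S_{2^n} g)`. -/
def funHpNormP (p : ℝ) (g : G → ℝ) : ℝ≥0∞ := ∫⁻ x, funMaximal g x ^ p ∂μG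

/-- `‖g‖_{L_p}^p = ∫ |g|^p dμ`. -/
def funLpNormP (p : ℝ) (g : G → ℝ) : ℝ≥0∞ := ∫⁻ x, ENNReal.ofReal |g x| ^ p ∂μG

/-- The weak `L_p` quasinorm `‖g‖_{L_{p,∞}} = sup_{λ>0} λ μ({|g|>λ})^{1/p}`. -/
def weakLpNorm (p : ℝ) (g : G → ℝ) : ℝ≥0∞ :=
  ⨆ (t : ℝ) (_ : 0 < t), ENNReal.ofReal t * μG {x : G | t < |g x|} ^ (1 / p)

/-- The Walsh–Kaczmarz–Fourier coefficient of a martingale: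
`f̂(i) = lim_k ∫ f^{(k)} κ_i dμ`. -/
def martCoeffK (f : ℕ → G → ℝ) (i : ℕ) : ℝ :=
  limUnder atTop (fun k => ∫ x, f k x * kacz i x ∂μG)

/-- The `n`-th Walsh–Kaczmarz partial sum of a martingale. -/
def martSK (f : ℕ → G → ℝ) (n : ℕ) (x : G) : ℝ :=
  ∑ k ∈ Finset.range n, martCoeffK f k * kacz k x

/-- The `n`-th Walsh–Kaczmarz Fejér mean of a martingale. -/
def martSigmaK (f : ℕ → G → ℝ) (n : ℕ) (x : G) : ℝ :=
  (1 / (n : ℝ)) * ∑ j ∈ Finset.range (n + 1), martSK f j x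

/-- A `p`-atom supported on the dyadic interval `I_n(x₀)`. -/
def IsPAtomOn (p : ℝ) (n : ℕ) (x₀ : G) (a : G → ℝ) : Prop :=
  Measurable a ∧ (∀ y, y ∉ I n x₀ → a y = 0) ∧ (∫ y in I n x₀, a y ∂μG) = 0 ∧
    ∀ y, ENNReal.ofReal |a y| ≤ μG (I n x₀) ^ (-(1 / p))

/-- A `p`-atom. -/
def IsPAtom (p : ℝ) (a : G → ℝ) : Prop := ∃ n x₀, IsPAtomOn p n x₀ a

end WalshKaczmarz
namespace WalshKaczmarz

/-- The kernel `L_m^2 = (1/m) ∑_{i<|m|} 2^i r_i ⋅ (K_{2^i}^w ∘ τ_i)`. -/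
def L2 (m : ℕ) (x : G) : ℝ :=
  (1 / (m : ℝ)) *
    ∑ i ∈ Finset.range (order m), (2 : ℝ) ^ i * rademacher i x * fejW (2 ^ i) (tau i x)

lemma abs_rademacher (k : ℕ) (x : G) : |rademacher k x| = 1 := by
  simp [rademacher]

lemma rademacher_of_eq_one {k : ℕ} {x : G} (h : x k = 1) : rademacher k x = -1 := by
  simp [rademacher, h, ZMod.val_one]

lemma abs_one_add_rademacher_le (k : ℕ) (x : G) : |1 + rademacher k x| ≤ 2 := by
  have h := abs_add_le 1 (rademacher k x)
  rw [abs_rademacher, abs_one] at h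
  linarith

lemma walsh_eq_prod {n k : ℕ} (h : k < 2 ^ n) (x : G) :
    walsh k x = ∏ j ∈ Finset.range n, (if k.testBit j then rademacher j x else 1) := by
  have key : ∀ a b : ℕ, k < 2 ^ a →
      ∏ j ∈ Finset.range a, (if k.testBit j then rademacher j x else 1) =
        ∏ j ∈ Finset.range (max a b), (if k.testBit j then rademacher j x else 1) := by
    intro a b ha
    refine Finset.prod_subset (Finset.range_mono (le_max_left a b)) fun j _ hj => ?_
    have hk : k < 2 ^ j :=
      ha.trans_le (Nat.pow_le_pow_right two_pos (by simpa using hj))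
    simp [Nat.testBit_lt_two_pow hk]
  rw [walsh, key k n Nat.lt_two_pow_self, key n k h, max_comm]

lemma walsh_two_pow_add {n k : ℕ} (h : k < 2 ^ n) (x : G) :
    walsh (2 ^ n + k) x = rademacher n x * walsh k x := by
  have h' : 2 ^ n + k < 2 ^ (n + 1) := by rw [pow_succ]; omega
  rw [walsh_eq_prod h', walsh_eq_prod h, Finset.prod_range_succ, mul_comm]
  congr 1
  · simp [Nat.testBit_two_pow_add_eq, Nat.testBit_lt_two_pow h]
  · refine Finset.prod_congr rfl fun j hj => ?_
    rw [Nat.testBit_two_pow_add_gt (Finset.mem_range.1 hj)]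

lemma abs_walsh (n : ℕ) (x : G) : |walsh n x| = 1 := by
  rw [walsh, Finset.abs_prod]
  refine Finset.prod_eq_one fun k _ => ?_
  split_ifs <;> simp [abs_rademacher]

lemma abs_dirW_le (n : ℕ) (x : G) : |dirW n x| ≤ n := by
  refine (Finset.abs_sum_le_sum_abs _ _).trans ?_
  simp [abs_walsh]

lemma dirW_two_pow_add {n k : ℕ} (h : k ≤ 2 ^ n) (x : G) :
    dirW (2 ^ n + k) x = dirW (2 ^ n) x + rademacher n x * dirW k x := by
  rw [dirW, Finset.sum_range_add, dirW, dirW, Finset.mul_sum]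
  congr 1
  exact Finset.sum_congr rfl fun j hj =>
    walsh_two_pow_add ((Finset.mem_range.1 hj).trans_le h) x

lemma dirW_two_pow_succ (n : ℕ) (x : G) :
    dirW (2 ^ (n + 1)) x = (1 + rademacher n x) * dirW (2 ^ n) x := by
  rw [pow_succ, mul_two, dirW_two_pow_add le_rfl]
  ring

lemma dirW_two_pow_eq_zero {n j : ℕ} {x : G} (hj : x j = 1) (h : j < n) :
    dirW (2 ^ n) x = 0 := by
  induction n, h using Nat.le_induction with
  | base => rw [dirW_two_pow_succ, rademacher_of_eq_one hj]; ring
  | succ n _ ih => rw [dirW_two_pow_succ, ih, mul_zero]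

/-- The unnormalized dyadic Fejér kernel `2^n K_{2^n}^w`. -/
def dyadicFejerSum (n : ℕ) (x : G) : ℝ := ∑ k ∈ Finset.range (2 ^ n + 1), dirW k x

lemma two_pow_mul_fejW (n : ℕ) (x : G) :
    (2 : ℝ) ^ n * fejW (2 ^ n) x = dyadicFejerSum n x := by
  rw [fejW, dyadicFejerSum]
  push_cast
  field_simp

lemma dyadicFejerSum_eq (n : ℕ) (x : G) :
    dyadicFejerSum n x = ∑ k ∈ Finset.range (2 ^ n), dirW (k + 1) x := by
  rw [dyadicFejerSum, Finset.sum_range_succ']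
  simp [dirW]

lemma dyadicFejerSum_succ (n : ℕ) (x : G) :
    dyadicFejerSum (n + 1) x =
      (1 + rademacher n x) * dyadicFejerSum n x + 2 ^ n * dirW (2 ^ n) x := by
  have h : ∀ k ∈ Finset.range (2 ^ n), dirW (2 ^ n + k + 1) x =
      dirW (2 ^ n) x + rademacher n x * dirW (k + 1) x := fun k hk =>
    dirW_two_pow_add (Finset.mem_range.1 hk) x
  simp only [dyadicFejerSum_eq]
  rw [pow_succ, mul_two, Finset.sum_range_add, Finset.sum_congr rfl h, Finset.sum_add_distrib,
    ← Finset.mul_sum]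
  simp
  ring

lemma abs_dyadicFejerSum_le (n : ℕ) (x : G) : |dyadicFejerSum n x| ≤ 4 ^ n := by
  rw [dyadicFejerSum_eq]
  refine (Finset.abs_sum_le_sum_abs _ _).trans ?_
  have h : ∀ k ∈ Finset.range (2 ^ n), |dirW (k + 1) x| ≤ (2 : ℝ) ^ n := fun k hk =>
    (abs_dirW_le _ _).trans (by exact_mod_cast Finset.mem_range.1 hk)
  refine (Finset.sum_le_card_nsmul _ _ _ h).trans (le_of_eq ?_)
  rw [Finset.card_range, nsmul_eq_mul]
  push_cast
  rw [← mul_pow]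
  norm_num

lemma abs_dyadicFejerSum_le_of_eq_one {n j : ℕ} {x : G} (hj : x j = 1) (h : j < n) :
    |dyadicFejerSum n x| ≤ 2 ^ (n + j) := by
  induction n, h using Nat.le_induction with
  | base =>
    rw [dyadicFejerSum_succ, rademacher_of_eq_one hj, add_neg_cancel, zero_mul, zero_add, abs_mul]
    have hd : |dirW (2 ^ j) x| ≤ (2 : ℝ) ^ j := by exact_mod_cast abs_dirW_le (2 ^ j) x
    rw [abs_of_pos (by positivity : (0 : ℝ) < 2 ^ j), Nat.succ_eq_add_one]
    calc (2 : ℝ) ^ j * |dirW (2 ^ j) x| ≤ 2 ^ j * 2 ^ j := by gcongr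
      _ ≤ 2 ^ (j + 1 + j) := by
        rw [← pow_add]; exact pow_le_pow_right₀ one_le_two (by omega)
  | succ n hn ih =>
    rw [dyadicFejerSum_succ, dirW_two_pow_eq_zero hj hn, mul_zero, add_zero, abs_mul]
    calc _ ≤ 2 * (2 : ℝ) ^ (n + j) := by
          gcongr
          exact abs_one_add_rademacher_le n x
      _ = 2 ^ (n + 1 + j) := by ring

lemma dyadicFejerSum_eq_zero {n i j : ℕ} {x : G} (hi : x i = 1) (hj : x j = 1) (hij : i < j)
    (h : j < n) : dyadicFejerSum n x = 0 := by
  induction n, h using Nat.le_induction with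
  | base =>
    rw [dyadicFejerSum_succ, rademacher_of_eq_one hj, dirW_two_pow_eq_zero hi hij]
    ring
  | succ n hn ih =>
    rw [dyadicFejerSum_succ, ih, dirW_two_pow_eq_zero hj hn]
    ring

lemma tau_apply_reflect {i k : ℕ} (h : k < i) (x : G) : tau i x (i - 1 - k) = x k := by
  rw [tau, if_pos (by omega)]
  congr 1
  omega

/-- A majorant of `|2^i K_{2^i}^w ∘ τ_i|` at points whose coordinates `t < l` equal `1`. -/
def fejerMajorant (t l i : ℕ) : ℝ :=
  if i ≤ t then 4 ^ i else if i ≤ l then 2 ^ (2 * i - 1 - t) else 0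

lemma fejerMajorant_nonneg (t l i : ℕ) : 0 ≤ fejerMajorant t l i := by
  unfold fejerMajorant
  split_ifs <;> positivity

lemma abs_dyadicFejerSum_tau_le {t l : ℕ} {y : G} (htl : t < l) (ht : y t = 1) (hl : y l = 1)
    (i : ℕ) : |dyadicFejerSum i (tau i y)| ≤ fejerMajorant t l i := by
  unfold fejerMajorant
  split_ifs with h₁ h₂
  · exact abs_dyadicFejerSum_le _ _
  · have hi : t < i := not_le.1 h₁
    convert abs_dyadicFejerSum_le_of_eq_one ((tau_apply_reflect hi y).trans ht)
      (by omega : i - 1 - t < i) using 2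
    omega
  · have hi : l < i := not_le.1 h₂
    rw [dyadicFejerSum_eq_zero ((tau_apply_reflect hi y).trans hl)
      ((tau_apply_reflect (htl.trans hi) y).trans ht) (by omega) (by omega), abs_zero]

lemma sum_four_pow_le (t : ℕ) : ∑ i ∈ Finset.range (t + 1), (4 : ℝ) ^ i ≤ 2 * 2 ^ (2 * t) := by
  induction t with
  | zero => simp
  | succ t ih =>
    rw [Finset.sum_range_succ]
    have h₁ : (4 : ℝ) ^ (t + 1) = 4 * 2 ^ (2 * t) := by
      rw [pow_succ, pow_mul]; norm_num; ring
    have h₂ : (2 : ℝ) ^ (2 * (t + 1)) = 4 * 2 ^ (2 * t) := by ring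
    have h₃ : (0 : ℝ) < 2 ^ (2 * t) := by positivity
    linarith

lemma sum_range_fejerMajorant_le {t l k : ℕ} (htk : t ≤ k) (hkl : k ≤ l) :
    ∑ i ∈ Finset.range (k + 1), fejerMajorant t l i ≤ 2 * 2 ^ (2 * t) + 2 ^ (2 * k - t) := by
  induction k, htk using Nat.le_induction with
  | base =>
    have h : ∀ i ∈ Finset.range (t + 1), fejerMajorant t l i = 4 ^ i := fun i hi =>
      if_pos (Nat.lt_succ_iff.1 (Finset.mem_range.1 hi))
    rw [Finset.sum_congr rfl h]
    have := sum_four_pow_le t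
    have : (0 : ℝ) < 2 ^ (2 * t - t) := by positivity
    linarith
  | succ k hk ih =>
    rw [Finset.sum_range_succ, fejerMajorant, if_neg (by omega), if_pos hkl,
      show 2 * (k + 1) - 1 - t = 2 * k - t + 1 by omega,
      show 2 * (k + 1) - t = 2 * k - t + 2 by omega, pow_succ, pow_add]
    have := ih (by omega)
    have : (0 : ℝ) < 2 ^ (2 * k - t) := by positivity
    linarith

lemma sum_fejerMajorant_le {t l : ℕ} (htl : t < l) (n : ℕ) :
    ∑ i ∈ Finset.range n, fejerMajorant t l i ≤ 2 * 2 ^ (2 * t) + 2 ^ (2 * l - t) := by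
  refine le_trans ?_ (sum_range_fejerMajorant_le htl.le le_rfl)
  have hsub : Finset.range (l + 1) ⊆ Finset.range (max n (l + 1)) :=
    Finset.range_mono (le_max_right n (l + 1))
  rw [Finset.sum_subset hsub fun i _ hi => ?_]
  · exact Finset.sum_le_sum_of_subset_of_nonneg (Finset.range_mono (le_max_left n (l + 1)))
      fun i _ _ => fejerMajorant_nonneg t l i
  · rw [Finset.mem_range, not_lt] at hi
    rw [fejerMajorant, if_neg (by omega), if_neg (by omega)]

lemma abs_L2_le {t l : ℕ} {y : G} (htl : t < l) (ht : y t = 1) (hl : y l = 1) (m : ℕ) :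
    |L2 m y| ≤ (2 * 2 ^ (2 * t) + 2 ^ (2 * l - t)) / m := by
  rw [L2, abs_mul, abs_of_nonneg (by positivity : (0 : ℝ) ≤ 1 / m), one_div_mul_eq_div]
  gcongr
  refine (Finset.abs_sum_le_sum_abs _ _).trans
    (le_trans (Finset.sum_le_sum fun i _ => ?_) (sum_fejerMajorant_le htl (order m)))
  rw [mul_right_comm, two_pow_mul_fejW, abs_mul, abs_rademacher, mul_one]
  exact abs_dyadicFejerSum_tau_le htl ht hl i

lemma measurableSet_I (n : ℕ) (x : G) : MeasurableSet (I n x) := by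
  have h : I n x = ⋂ k ∈ Finset.range n, (fun y : G => y k) ⁻¹' {x k} := by
    ext y; simp [I]
  rw [h]
  exact Finset.measurableSet_biInter _ fun k _ => measurable_pi_apply k trivial

lemma mul_two_pow_lt_one_of_floor_even {a : ℝ} (h₁ : a < 1) {n : ℕ}
    (h : ∀ k < n, ((⌊a * 2 ^ (k + 1)⌋ : ℤ) : ZMod 2) = 0) : a * 2 ^ n < 1 := by
  induction n with
  | zero => simpa using h₁
  | succ n ih =>
    have hn := ih fun k hk => h k (by omega)
    have hdvd : (2 : ℤ) ∣ ⌊a * 2 ^ (n + 1)⌋ :=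
      (ZMod.intCast_zmod_eq_zero_iff_dvd _ 2).1 (h n (by omega))
    have hlt : ⌊a * 2 ^ (n + 1)⌋ < 2 := by
      rw [Int.floor_lt, pow_succ]; push_cast; linarith
    have hle : ⌊a * 2 ^ (n + 1)⌋ < 1 := by omega
    simpa [Int.floor_lt] using hle

lemma μG_I_zero_le (n : ℕ) : μG (I n 0) ≤ ENNReal.ofReal (2 ^ (-(n : ℤ))) := by
  have hmeas : Measurable
      (fun t : ℝ => fun k : ℕ => ((⌊t * 2 ^ (k + 1)⌋ : ℤ) : ZMod 2)) :=
    measurable_pi_lambda _ fun k =>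
      (measurable_of_countable (fun z : ℤ => (z : ZMod 2))).comp
        (Int.measurable_floor.comp (measurable_id.mul_const _))
  rw [μG, Measure.map_apply hmeas (measurableSet_I n 0),
    Measure.restrict_apply (hmeas (measurableSet_I n 0))]
  have hsub : (fun t : ℝ => fun k : ℕ => ((⌊t * 2 ^ (k + 1)⌋ : ℤ) : ZMod 2)) ⁻¹' I n 0 ∩
      Set.Ico 0 1 ⊆ Set.Ico 0 (2 ^ (-(n : ℤ))) := by
    rintro a ⟨ha, h₀, h₁⟩
    refine ⟨h₀, ?_⟩
    rw [zpow_neg, zpow_natCast, ← one_div, lt_div_iff₀ (by positivity)]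
    exact mul_two_pow_lt_one_of_floor_even h₁ ha
  refine (measure_mono hsub).trans ?_
  rw [Real.volume_Ico, sub_zero]

/-- There is an absolute constant `c` such that for `0 ≤ t < l < N`, `m ≥ 1` and
`x ∈ J_t^l` (i.e. `x_0 = ⋯ = x_{t-1} = 0`, `x_t = 1`, `x_{t+1} = ⋯ = x_{l-1} = 0`,
`x_l = 1`, the remaining coordinates arbitrary),
`∫_{I_N} |L_m^2(x+s)| dμ(s) ≤ c (2^{2t} + 2^{2l-t}) 2^{-N} / m`. -/
theorem L2_integral_bound_J :
    ∃ c : ℝ, ∀ (N t l m : ℕ) (x : G), t < l → l < N → 1 ≤ m →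
      ((∀ k, k < t → x k = 0) ∧ x t = 1 ∧ (∀ k, t < k → k < l → x k = 0) ∧ x l = 1) →
      (∫ s in I N 0, |L2 m (x + s)| ∂μG) ≤
        c * ((2 : ℝ) ^ (2 * t) + 2 ^ (2 * l - t)) * (2 : ℝ) ^ (-(N : ℤ)) / m := by
  refine ⟨2, fun N t l m x htl hlN _ ⟨_, ht, _, hl⟩ => ?_⟩
  have hμ := μG_I_zero_le N
  have hbound : ∀ s ∈ I N 0,
      ‖|L2 m (x + s)|‖ ≤ (2 * 2 ^ (2 * t) + 2 ^ (2 * l - t)) / (m : ℝ) := by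
    intro s hs
    rw [Real.norm_eq_abs, abs_abs]
    refine abs_L2_le htl ?_ ?_ m
    · simp [ht, hs t (htl.trans hlN)]
    · simp [hl, hs l hlN]
  have hreal : μG.real (I N 0) ≤ 2 ^ (-(N : ℤ)) :=
    ENNReal.toReal_le_of_le_ofReal (by positivity) hμ
  calc ∫ s in I N 0, |L2 m (x + s)| ∂μG
      ≤ (2 * 2 ^ (2 * t) + 2 ^ (2 * l - t)) / (m : ℝ) * μG.real (I N 0) :=
        (le_abs_self _).trans
          (norm_setIntegral_le_of_norm_le_const (hμ.trans_lt ENNReal.ofReal_lt_top) hbound)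
    _ ≤ (2 * (2 ^ (2 * t) + 2 ^ (2 * l - t))) / (m : ℝ) * 2 ^ (-(N : ℤ)) := by
        gcongr
        have : (0 : ℝ) < 2 ^ (2 * l - t) := by positivity
        linarith
    _ = _ := by ring

end WalshKaczmarz
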